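/- Let L₊ be a random variable that equals +∞ with probability 1 - β and equals ln β with probability β, where β = Φ((τ* - τ)/σ)^{a} for some a ≥ 0, σ > 0, τ* > τ. Let L₋ be the constant random variable -ln β. Then for every ε > 0: P(L₊ ≥ ε) - e^ε P(L₋ ≤ -ε) = 1 - β, and P(L₋ ≥ ε) - e^ε P(L₊ ≤ -ε) equals 1 - e^ε β if ε ≤ -ln β and equals 0 otherwise; consequently both are at most 1 - β. -/

import Mathlib

noncomputable def stdNormalPDF (x : ℝ) : ℝ :=
  (Real.sqrt (2 * Real.pi))⁻¹ * Real.exp (-x ^ 2 / 2)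

noncomputable def stdNormalCDF (x : ℝ) : ℝ := ∫ t in Set.Iic x, stdNormalPDF t

noncomputable def gaussF (μ ε : ℝ) : ℝ :=
  stdNormalCDF (μ / 2 - ε / μ) - Real.exp ε * stdNormalCDF (-μ / 2 - ε / μ)

theorem stdNormalPDF_eq : stdNormalPDF = ProbabilityTheory.gaussianPDFReal 0 1 := by
  funext x
  simp [stdNormalPDF, ProbabilityTheory.gaussianPDFReal]

theorem stdNormalPDF_nonneg (x : ℝ) : 0 ≤ stdNormalPDF x := by
  unfold stdNormalPDF
  positivity

theorem stdNormalCDF_nonneg (x : ℝ) : 0 ≤ stdNormalCDF x :=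
  MeasureTheory.integral_nonneg fun t => stdNormalPDF_nonneg t

theorem stdNormalCDF_le_one (x : ℝ) : stdNormalCDF x ≤ 1 := by
  have h1 : ∫ t, stdNormalPDF t = 1 := by
    rw [stdNormalPDF_eq]
    exact ProbabilityTheory.integral_gaussianPDFReal_eq_one 0 one_ne_zero
  rw [← h1]
  refine MeasureTheory.setIntegral_le_integral ?_ (Filter.Eventually.of_forall stdNormalPDF_nonneg)
  rw [stdNormalPDF_eq]
  exact ProbabilityTheory.integrable_gaussianPDFReal 0 1

open MeasureTheory in
theorem threshold_plrv_eval (σ τ τs : ℝ) (hσ : 0 < σ) (hτ : τ < τs)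
    (a : ℕ) (ε : ℝ) (hε : 0 < ε) (β : ℝ)
    (hβ : β = stdNormalCDF ((τs - τ) / σ) ^ a) :
    let νp : Measure EReal :=
      ENNReal.ofReal (1 - β) • Measure.dirac (⊤ : EReal) +
        ENNReal.ofReal β • Measure.dirac ((Real.log β : ℝ) : EReal)
    let νm : Measure EReal := Measure.dirac (((-Real.log β : ℝ)) : EReal)
    ((νp {x | (ε : EReal) ≤ x}).toReal
        - Real.exp ε * (νm {x | x ≤ ((-ε : ℝ) : EReal)}).toReal = 1 - β) ∧
    ((νm {x | (ε : EReal) ≤ x}).toReal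
        - Real.exp ε * (νp {x | x ≤ ((-ε : ℝ) : EReal)}).toReal
      = if ε ≤ -Real.log β then 1 - Real.exp ε * β else 0) ∧
    ((νp {x | (ε : EReal) ≤ x}).toReal
        - Real.exp ε * (νm {x | x ≤ ((-ε : ℝ) : EReal)}).toReal ≤ 1 - β) ∧
    ((νm {x | (ε : EReal) ≤ x}).toReal
        - Real.exp ε * (νp {x | x ≤ ((-ε : ℝ) : EReal)}).toReal ≤ 1 - β) := by
  intro νp νm
  have h0 : 0 ≤ β := hβ ▸ pow_nonneg (stdNormalCDF_nonneg _) a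
  have h1 : β ≤ 1 := hβ ▸ pow_le_one₀ (stdNormalCDF_nonneg _) (stdNormalCDF_le_one _)
  have hl : Real.log β ≤ 0 := Real.log_nonpos h0 h1
  have hm1 : MeasurableSet {x : EReal | (ε : EReal) ≤ x} := measurableSet_Ici
  have hm2 : MeasurableSet {x : EReal | x ≤ ((-ε : ℝ) : EReal)} := measurableSet_Iic
  have e1 : (νp {x | (ε : EReal) ≤ x}).toReal = 1 - β := by
    have : ¬ ε ≤ Real.log β := by linarith
    simp only [νp, Measure.add_apply, Measure.smul_apply, Measure.dirac_apply' _ hm1,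
      Set.indicator_apply, Set.mem_ofPred_eq, EReal.coe_le_coe_iff, this, le_top]
    simp [h1]
  have e2 : (νm {x | x ≤ ((-ε : ℝ) : EReal)}).toReal = 0 := by
    have : ¬ -Real.log β ≤ -ε := by linarith
    simp only [νm, Measure.dirac_apply' _ hm2,
      Set.indicator_apply, Set.mem_ofPred_eq, EReal.coe_le_coe_iff, this]
    simp
  have e3 : (νm {x | (ε : EReal) ≤ x}).toReal = if ε ≤ -Real.log β then 1 else 0 := by
    simp only [νm, Measure.dirac_apply' _ hm1,
      Set.indicator_apply, Set.mem_ofPred_eq, EReal.coe_le_coe_iff]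
    split_ifs <;> simp
  have e4 : (νp {x | x ≤ ((-ε : ℝ) : EReal)}).toReal = if ε ≤ -Real.log β then β else 0 := by
    have ht : ¬ (⊤ : EReal) ≤ ((-ε : ℝ) : EReal) := not_le.mpr (EReal.coe_lt_top _)
    have hi : Real.log β ≤ -ε ↔ ε ≤ -Real.log β := le_neg
    simp only [νp, Measure.add_apply, Measure.smul_apply, Measure.dirac_apply' _ hm2,
      Set.indicator_apply, Set.mem_ofPred_eq, EReal.coe_le_coe_iff, ht, hi, if_false]
    split_ifs <;> simp [h0]
  rw [e1, e2, e3, e4]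
  have he : 1 ≤ Real.exp ε := Real.one_le_exp hε.le
  refine ⟨by ring, by split_ifs <;> ring, by linarith, ?_⟩
  split_ifs
  · nlinarith
  · linarith
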